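/- Fix x₁ ∈ (0,1) and assume that for all indices i,j,k,l ∈ {1,2} the limit L^{ij}_{kl} = lim_{x₂→0⁺} u^{ij}_{kl}(x₁,x₂) exists in ℝ. Then lim_{x₂→0⁺} Σ_{i,j,k,l∈{1,2}} u^{ij}_{kl}(x₁,x₂)·u^{kl}_{ij}(x₁,x₂) = (L¹¹₁₁)² + 4(L¹²₁₂)² + (L²²₂₂)². (This is the value of the squared Riemannian curvature norm |Rm|² on the edge x₂ = 0.) -/

import Mathlib

open Real Filter Set Topology

/-- First partial derivative of a function of two real variables. -/
noncomputable def pd1 (g : ℝ → ℝ → ℝ) : ℝ → ℝ → ℝ := fun x y => deriv (fun s => g s y) x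

/-- Second partial derivative of a function of two real variables. -/
noncomputable def pd2 (g : ℝ → ℝ → ℝ) : ℝ → ℝ → ℝ := fun x y => deriv (fun s => g x s) y

/-- The symplectic potential in Guillemin normal form near a corner:
`u(x₁,x₂) = (1/2)(x₁ log x₁ + x₂ log x₂) + f(x₁,x₂)`. -/
noncomputable def upot (f : ℝ → ℝ → ℝ) : ℝ → ℝ → ℝ :=
  fun x y => 1 / 2 * (x * Real.log x + y * Real.log y) + f x y

/-- Determinant `D = u₁₁ u₂₂ − u₁₂²` of the Hessian of `u`. -/
noncomputable def hessDet (f : ℝ → ℝ → ℝ) : ℝ → ℝ → ℝ :=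
  fun x y => pd1 (pd1 (upot f)) x y * pd2 (pd2 (upot f)) x y - (pd1 (pd2 (upot f)) x y) ^ 2

/-- Entry `u¹¹ = u₂₂ / D` of the inverse Hessian of `u`. -/
noncomputable def uInv11 (f : ℝ → ℝ → ℝ) : ℝ → ℝ → ℝ :=
  fun x y => pd2 (pd2 (upot f)) x y / hessDet f x y

/-- Entry `u¹² = u²¹ = −u₁₂ / D` of the inverse Hessian of `u`. -/
noncomputable def uInv12 (f : ℝ → ℝ → ℝ) : ℝ → ℝ → ℝ :=
  fun x y => -(pd1 (pd2 (upot f)) x y) / hessDet f x y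

/-- Entry `u²² = u₁₁ / D` of the inverse Hessian of `u`. -/
noncomputable def uInv22 (f : ℝ → ℝ → ℝ) : ℝ → ℝ → ℝ :=
  fun x y => pd1 (pd1 (upot f)) x y / hessDet f x y

/-- The partial derivative operators indexed by `Fin 2`. -/
noncomputable def pdI : Fin 2 → (ℝ → ℝ → ℝ) → (ℝ → ℝ → ℝ) := ![pd1, pd2]

/-- The inverse Hessian `(u^{ij})` of `u` as a matrix of functions. -/
noncomputable def uInvMat (f : ℝ → ℝ → ℝ) : Fin 2 → Fin 2 → ℝ → ℝ → ℝ :=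
  ![![uInv11 f, uInv12 f], ![uInv12 f, uInv22 f]]

/-- `u^{ij}_{kl} = ∂ₖ∂ₗ (u^{ij})`. -/
noncomputable def uCurv (f : ℝ → ℝ → ℝ) (i j k l : Fin 2) : ℝ → ℝ → ℝ :=
  pdI k (pdI l (uInvMat f i j))

/-- At a point of differentiability the first partial derivative is the Fréchet derivative in direction `(1,0)`. -/
lemma pd1_eq_fderiv {g : ℝ → ℝ → ℝ} {p : ℝ × ℝ}
    (hg : DifferentiableAt ℝ (Function.uncurry g) p) :
    pd1 g p.1 p.2 = fderiv ℝ (Function.uncurry g) p (1, 0) := by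
  have h : HasDerivAt (fun s : ℝ => (s, p.2)) ((1 : ℝ), (0 : ℝ)) p.1 :=
    (hasDerivAt_id p.1).prodMk (hasDerivAt_const p.1 p.2)
  exact (hg.hasFDerivAt.comp_hasDerivAt p.1 h).deriv

/-- At a point of differentiability the second partial derivative is the Fréchet derivative in direction `(0,1)`. -/
lemma pd2_eq_fderiv {g : ℝ → ℝ → ℝ} {p : ℝ × ℝ}
    (hg : DifferentiableAt ℝ (Function.uncurry g) p) :
    pd2 g p.1 p.2 = fderiv ℝ (Function.uncurry g) p (0, 1) := by
  have h : HasDerivAt (fun s : ℝ => (p.1, s)) ((0 : ℝ), (1 : ℝ)) p.2 :=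
    (hasDerivAt_const p.2 p.1).prodMk (hasDerivAt_id p.2)
  exact (hg.hasFDerivAt.comp_hasDerivAt p.2 h).deriv

lemma ContDiffOn.differentiableAt_of_isOpen {G : ℝ × ℝ → ℝ} {U : Set (ℝ × ℝ)} (hU : IsOpen U)
    (hg : ContDiffOn ℝ (⊤ : ℕ∞) G U) {p : ℝ × ℝ} (hp : p ∈ U) : DifferentiableAt ℝ G p :=
  (hg.contDiffAt (hU.mem_nhds hp)).differentiableAt (by simp)

lemma contDiffOn_fderiv_apply {G : ℝ × ℝ → ℝ} {U : Set (ℝ × ℝ)} (hU : IsOpen U)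
    (hg : ContDiffOn ℝ (⊤ : ℕ∞) G U) (v : ℝ × ℝ) :
    ContDiffOn ℝ (⊤ : ℕ∞) (fun p => fderiv ℝ G p v) U :=
  (hg.fderiv_of_isOpen hU (by simp)).clm_apply contDiffOn_const

lemma contDiffOn_pd1 {g : ℝ → ℝ → ℝ} {U : Set (ℝ × ℝ)} (hU : IsOpen U)
    (hg : ContDiffOn ℝ (⊤ : ℕ∞) (Function.uncurry g) U) :
    ContDiffOn ℝ (⊤ : ℕ∞) (Function.uncurry (pd1 g)) U :=
  (contDiffOn_fderiv_apply hU hg (1, 0)).congr fun _ hp =>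
    pd1_eq_fderiv (hg.differentiableAt_of_isOpen hU hp)

lemma contDiffOn_pd2 {g : ℝ → ℝ → ℝ} {U : Set (ℝ × ℝ)} (hU : IsOpen U)
    (hg : ContDiffOn ℝ (⊤ : ℕ∞) (Function.uncurry g) U) :
    ContDiffOn ℝ (⊤ : ℕ∞) (Function.uncurry (pd2 g)) U :=
  (contDiffOn_fderiv_apply hU hg (0, 1)).congr fun _ hp =>
    pd2_eq_fderiv (hg.differentiableAt_of_isOpen hU hp)

lemma contDiffOn_pdI (k : Fin 2) {g : ℝ → ℝ → ℝ} {U : Set (ℝ × ℝ)} (hU : IsOpen U)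
    (hg : ContDiffOn ℝ (⊤ : ℕ∞) (Function.uncurry g) U) :
    ContDiffOn ℝ (⊤ : ℕ∞) (Function.uncurry (pdI k g)) U := by
  fin_cases k
  · exact contDiffOn_pd1 hU hg
  · exact contDiffOn_pd2 hU hg

lemma eqOn_pdI (k : Fin 2) {g h : ℝ → ℝ → ℝ} {U : Set (ℝ × ℝ)} (hU : IsOpen U)
    (hgh : EqOn (Function.uncurry g) (Function.uncurry h) U) :
    EqOn (Function.uncurry (pdI k g)) (Function.uncurry (pdI k h)) U := by
  rintro ⟨x, y⟩ hp
  have h1 : ∀ᶠ q in 𝓝 (x, y), Function.uncurry g q = Function.uncurry h q :=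
    hgh.eventuallyEq_of_mem (hU.mem_nhds hp)
  fin_cases k
  · have ht : Tendsto (fun s : ℝ => (s, y)) (𝓝 x) (𝓝 (x, y)) :=
      Continuous.tendsto (by fun_prop) x
    exact Filter.EventuallyEq.deriv_eq (ht.eventually h1)
  · have ht : Tendsto (fun s : ℝ => (x, s)) (𝓝 y) (𝓝 (x, y)) :=
      Continuous.tendsto (by fun_prop) y
    exact Filter.EventuallyEq.deriv_eq (ht.eventually h1)

/-- Mixed partial derivatives of a smooth function commute. -/
lemma pd1_pd2_comm {g : ℝ → ℝ → ℝ} {U : Set (ℝ × ℝ)} (hU : IsOpen U)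
    (hg : ContDiffOn ℝ (⊤ : ℕ∞) (Function.uncurry g) U) {x y : ℝ} (hp : (x, y) ∈ U) :
    pd1 (pd2 g) x y = pd2 (pd1 g) x y := by
  have hd : DifferentiableAt ℝ (fderiv ℝ (Function.uncurry g)) (x, y) :=
    ((hg.fderiv_of_isOpen (m := (⊤ : ℕ∞)) hU (by simp)).contDiffAt
      (hU.mem_nhds hp)).differentiableAt (by simp)
  have key : ∀ v : ℝ × ℝ, fderiv ℝ (fun p => fderiv ℝ (Function.uncurry g) p v) (x, y) =
      (fderiv ℝ (fderiv ℝ (Function.uncurry g)) (x, y)).flip v := fun v => by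
    rw [fderiv_clm_apply hd (differentiableAt_const v)]
    simp
  have e1 : Function.uncurry (pd1 g) =ᶠ[𝓝 (x, y)]
      fun p => fderiv ℝ (Function.uncurry g) p (1, 0) :=
    Filter.eventually_of_mem (hU.mem_nhds hp) fun p hp =>
      pd1_eq_fderiv (hg.differentiableAt_of_isOpen hU hp)
  have e2 : Function.uncurry (pd2 g) =ᶠ[𝓝 (x, y)]
      fun p => fderiv ℝ (Function.uncurry g) p (0, 1) :=
    Filter.eventually_of_mem (hU.mem_nhds hp) fun p hp =>
      pd2_eq_fderiv (hg.differentiableAt_of_isOpen hU hp)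
  have h1 := pd1_eq_fderiv (p := (x, y))
    ((contDiffOn_pd2 hU hg).differentiableAt_of_isOpen hU hp)
  have h2 := pd2_eq_fderiv (p := (x, y))
    ((contDiffOn_pd1 hU hg).differentiableAt_of_isOpen hU hp)
  rw [e2.fderiv_eq, key] at h1
  rw [e1.fderiv_eq, key] at h2
  have hs : IsSymmSndFDerivAt ℝ (Function.uncurry g) (x, y) :=
    (hg.contDiffAt (hU.mem_nhds hp)).isSymmSndFDerivAt (by
      rw [minSmoothness_of_isRCLikeNormedField]
      exact WithTop.coe_le_coe.2 (le_top (a := (2 : ℕ∞))))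
  simp only [ContinuousLinearMap.flip_apply] at h1 h2
  rw [h1, h2]
  exact hs.eq _ _

/-- A function on a right neighbourhood of `0` with bounded derivative is bounded. -/
lemma isBigO_one_of_deriv {φ : ℝ → ℝ} (hd : ∀ᶠ y in 𝓝[>] (0 : ℝ), DifferentiableAt ℝ φ y)
    (hb : deriv φ =O[𝓝[>] (0 : ℝ)] (fun _ => (1 : ℝ))) :
    φ =O[𝓝[>] (0 : ℝ)] (fun _ => (1 : ℝ)) := by
  obtain ⟨C, hC⟩ := hb.bound
  obtain ⟨δ, hδ, hs⟩ := mem_nhdsGT_iff_exists_Ioo_subset.1 (hd.and hC)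
  have hδ' : (0 : ℝ) < δ := hδ
  have hm : δ / 2 ∈ Ioo 0 δ := ⟨by linarith, by linarith⟩
  have hC0 : 0 ≤ C := by
    have := (hs hm).2
    simp only [norm_one, mul_one] at this
    exact (norm_nonneg _).trans this
  refine Asymptotics.IsBigO.of_bound (‖φ (δ / 2)‖ + C * δ) ?_
  filter_upwards [Ioo_mem_nhdsGT hδ'] with y hy
  have h := (convex_Ioo 0 δ).norm_image_sub_le_of_norm_deriv_le (f := φ) (C := C)
    (fun z hz => (hs hz).1) (fun z hz => by simpa using (hs hz).2) hm hy
  have h2 : ‖y - δ / 2‖ ≤ δ := by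
    rw [Real.norm_eq_abs, abs_le]
    constructor <;> linarith [hy.1, hy.2]
  have h3 := norm_sub_norm_le (φ y) (φ (δ / 2))
  have h4 := mul_le_mul_of_nonneg_left h2 hC0
  simp only [norm_one, mul_one]
  linarith

/-- The entry `u₁₁`, which extends smoothly across the edge `y = 0`. -/
noncomputable def edgeA (f : ℝ → ℝ → ℝ) : ℝ → ℝ → ℝ :=
  fun x y => 1 / (2 * x) + pd1 (pd1 f) x y

/-- The rescaled entry `2 y u₂₂`, which extends smoothly across the edge `y = 0`. -/
noncomputable def edgeN (f : ℝ → ℝ → ℝ) : ℝ → ℝ → ℝ :=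
  fun x y => 1 + 2 * y * pd2 (pd2 f) x y

/-- The rescaled determinant `2 y D`, which extends smoothly across the edge `y = 0`. -/
noncomputable def edgeE (f : ℝ → ℝ → ℝ) : ℝ → ℝ → ℝ :=
  fun x y => edgeA f x y * edgeN f x y - 2 * y * (pd1 (pd2 f) x y) ^ 2

/-- The inverse Hessian with numerators and denominator rescaled by `2 y`. -/
noncomputable def edgeMat (f : ℝ → ℝ → ℝ) : Fin 2 → Fin 2 → ℝ → ℝ → ℝ :=
  ![![fun x y => edgeN f x y / edgeE f x y,
      fun x y => y * (-2 * pd1 (pd2 f) x y / edgeE f x y)],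
    ![fun x y => y * (-2 * pd1 (pd2 f) x y / edgeE f x y),
      fun x y => y * (2 * edgeA f x y / edgeE f x y)]]

lemma differentiable_slice {g : ℝ → ℝ → ℝ} (hg : ContDiff ℝ (⊤ : ℕ∞) (Function.uncurry g))
    (x y : ℝ) : DifferentiableAt ℝ (fun s => g s y) x ∧ DifferentiableAt ℝ (fun s => g x s) y := by
  have h : Differentiable ℝ (Function.uncurry g) := hg.differentiable (by simp)
  have h1 : Differentiable ℝ fun s : ℝ => Function.uncurry g (s, y) := by fun_prop
  have h2 : Differentiable ℝ fun s : ℝ => Function.uncurry g (x, s) := by fun_prop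
  exact ⟨h1 x, h2 y⟩

lemma contDiff_pd {g : ℝ → ℝ → ℝ} (hg : ContDiff ℝ (⊤ : ℕ∞) (Function.uncurry g)) :
    ContDiff ℝ (⊤ : ℕ∞) (Function.uncurry (pd1 g)) ∧
      ContDiff ℝ (⊤ : ℕ∞) (Function.uncurry (pd2 g)) :=
  ⟨contDiffOn_univ.1 (contDiffOn_pd1 isOpen_univ hg.contDiffOn),
    contDiffOn_univ.1 (contDiffOn_pd2 isOpen_univ hg.contDiffOn)⟩

lemma hasDerivAt_half_log_add_one {x : ℝ} (hx : x ≠ 0) :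
    HasDerivAt (fun s => 1 / 2 * (Real.log s + 1)) (1 / (2 * x)) x := by
  have h : 1 / (2 * x) = 1 / 2 * x⁻¹ := by rw [one_div, mul_inv, one_div]
  exact h ▸ ((Real.hasDerivAt_log hx).add_const 1).const_mul (1 / 2)

lemma pd1_upot {f : ℝ → ℝ → ℝ} (hf : ContDiff ℝ (⊤ : ℕ∞) (Function.uncurry f)) {x : ℝ}
    (hx : x ≠ 0) (y : ℝ) : pd1 (upot f) x y = 1 / 2 * (Real.log x + 1) + pd1 f x y :=
  ((((Real.hasDerivAt_mul_log hx).add_const (y * Real.log y)).const_mul (1 / 2)).add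
    (differentiable_slice hf x y).1.hasDerivAt).deriv

lemma pd2_upot {f : ℝ → ℝ → ℝ} (hf : ContDiff ℝ (⊤ : ℕ∞) (Function.uncurry f)) (x : ℝ) {y : ℝ}
    (hy : y ≠ 0) : pd2 (upot f) x y = 1 / 2 * (Real.log y + 1) + pd2 f x y :=
  ((((Real.hasDerivAt_mul_log hy).const_add (x * Real.log x)).const_mul (1 / 2)).add
    (differentiable_slice hf x y).2.hasDerivAt).deriv

lemma pd1_pd1_upot {f : ℝ → ℝ → ℝ} (hf : ContDiff ℝ (⊤ : ℕ∞) (Function.uncurry f)) {x : ℝ}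
    (hx : x ≠ 0) (y : ℝ) : pd1 (pd1 (upot f)) x y = edgeA f x y := by
  have h : (fun s => pd1 (upot f) s y) =ᶠ[𝓝 x]
      (fun s => 1 / 2 * (Real.log s + 1)) + fun s => pd1 f s y := by
    filter_upwards [isOpen_ne.mem_nhds hx] with s hs using pd1_upot hf hs y
  exact h.deriv_eq.trans ((hasDerivAt_half_log_add_one hx).add
    (differentiable_slice (contDiff_pd hf).1 x y).1.hasDerivAt).deriv

lemma pd2_pd2_upot {f : ℝ → ℝ → ℝ} (hf : ContDiff ℝ (⊤ : ℕ∞) (Function.uncurry f)) (x : ℝ)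
    {y : ℝ} (hy : y ≠ 0) : pd2 (pd2 (upot f)) x y = edgeN f x y / (2 * y) := by
  have h : (fun s => pd2 (upot f) x s) =ᶠ[𝓝 y]
      (fun s => 1 / 2 * (Real.log s + 1)) + fun s => pd2 f x s := by
    filter_upwards [isOpen_ne.mem_nhds hy] with s hs using pd2_upot hf x hs
  have h2 : pd2 (pd2 (upot f)) x y = 1 / (2 * y) + pd2 (pd2 f) x y :=
    h.deriv_eq.trans ((hasDerivAt_half_log_add_one hy).add
      (differentiable_slice (contDiff_pd hf).2 x y).2.hasDerivAt).deriv
  rw [h2, edgeN]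
  field_simp

lemma pd1_pd2_upot {f : ℝ → ℝ → ℝ} (hf : ContDiff ℝ (⊤ : ℕ∞) (Function.uncurry f)) (x : ℝ)
    {y : ℝ} (hy : y ≠ 0) : pd1 (pd2 (upot f)) x y = pd1 (pd2 f) x y := by
  have h : (fun s => pd2 (upot f) s y) = fun s => 1 / 2 * (Real.log y + 1) + pd2 f s y :=
    funext fun s => pd2_upot hf s hy
  simp only [pd1, h, deriv_const_add]

lemma hessDet_eq {f : ℝ → ℝ → ℝ} (hf : ContDiff ℝ (⊤ : ℕ∞) (Function.uncurry f)) {x y : ℝ}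
    (hx : x ≠ 0) (hy : y ≠ 0) : hessDet f x y = edgeE f x y / (2 * y) := by
  rw [hessDet, pd1_pd1_upot hf hx, pd2_pd2_upot hf x hy, pd1_pd2_upot hf x hy, edgeE]
  field_simp

lemma uInvMat_eq {f : ℝ → ℝ → ℝ} (hf : ContDiff ℝ (⊤ : ℕ∞) (Function.uncurry f)) {x y : ℝ}
    (hx : x ≠ 0) (hy : y ≠ 0) (i j : Fin 2) : uInvMat f i j x y = edgeMat f i j x y := by
  have h2 : 2 * y ≠ 0 := by simpa using hy
  have h11 : uInv11 f x y = edgeN f x y / edgeE f x y := by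
    rw [uInv11, hessDet_eq hf hx hy, pd2_pd2_upot hf x hy, div_div_div_cancel_right₀ h2]
  have h12 : uInv12 f x y = y * (-2 * pd1 (pd2 f) x y / edgeE f x y) := by
    rw [uInv12, hessDet_eq hf hx hy, pd1_pd2_upot hf x hy, div_div_eq_mul_div]
    ring
  have h22 : uInv22 f x y = y * (2 * edgeA f x y / edgeE f x y) := by
    rw [uInv22, hessDet_eq hf hx hy, pd1_pd1_upot hf hx, div_div_eq_mul_div]
    ring
  fin_cases i <;> fin_cases j
  exacts [h11, h12, h12, h22]

lemma isOpen_ne_zero_fst : IsOpen {p : ℝ × ℝ | p.1 ≠ 0} :=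
  isOpen_ne_fun continuous_fst continuous_const

lemma contDiffOn_edgeA {f : ℝ → ℝ → ℝ} (hf : ContDiff ℝ (⊤ : ℕ∞) (Function.uncurry f)) :
    ContDiffOn ℝ (⊤ : ℕ∞) (Function.uncurry (edgeA f)) {p | p.1 ≠ 0} :=
  (ContDiffOn.div (f := fun _ => (1 : ℝ)) (g := fun p : ℝ × ℝ => 2 * p.1) contDiffOn_const
    (contDiffOn_const.mul contDiffOn_fst) fun _ hp => mul_ne_zero two_ne_zero hp).add
    (contDiff_pd (contDiff_pd hf).1).1.contDiffOn

lemma contDiff_edgeN {f : ℝ → ℝ → ℝ} (hf : ContDiff ℝ (⊤ : ℕ∞) (Function.uncurry f)) :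
    ContDiff ℝ (⊤ : ℕ∞) (Function.uncurry (edgeN f)) :=
  contDiff_const.add ((contDiff_const.mul contDiff_snd).mul (contDiff_pd (contDiff_pd hf).2).2)

lemma contDiffOn_edgeE {f : ℝ → ℝ → ℝ} (hf : ContDiff ℝ (⊤ : ℕ∞) (Function.uncurry f)) :
    ContDiffOn ℝ (⊤ : ℕ∞) (Function.uncurry (edgeE f)) {p | p.1 ≠ 0} :=
  ((contDiffOn_edgeA hf).mul (contDiff_edgeN hf).contDiffOn).sub
    ((contDiff_const.mul contDiff_snd).mul ((contDiff_pd (contDiff_pd hf).2).1.pow 2)).contDiffOn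

/-- The domain on which the rescaled inverse Hessian is smooth. -/
def edgeDomain (f : ℝ → ℝ → ℝ) : Set (ℝ × ℝ) :=
  {p | p.1 ≠ 0} ∩ Function.uncurry (edgeE f) ⁻¹' {0}ᶜ

lemma isOpen_edgeDomain {f : ℝ → ℝ → ℝ} (hf : ContDiff ℝ (⊤ : ℕ∞) (Function.uncurry f)) :
    IsOpen (edgeDomain f) :=
  (contDiffOn_edgeE hf).continuousOn.isOpen_inter_preimage isOpen_ne_zero_fst
    isOpen_compl_singleton

lemma contDiffOn_div_edgeE {f g : ℝ → ℝ → ℝ} (hf : ContDiff ℝ (⊤ : ℕ∞) (Function.uncurry f))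
    (hg : ContDiffOn ℝ (⊤ : ℕ∞) (Function.uncurry g) {p | p.1 ≠ 0}) :
    ContDiffOn ℝ (⊤ : ℕ∞) (Function.uncurry fun x y => g x y / edgeE f x y) (edgeDomain f) :=
  (hg.mono inter_subset_left).div ((contDiffOn_edgeE hf).mono inter_subset_left)
    fun _ hp => hp.2

lemma contDiffOn_edgeA_div {f : ℝ → ℝ → ℝ} (hf : ContDiff ℝ (⊤ : ℕ∞) (Function.uncurry f)) :
    ContDiffOn ℝ (⊤ : ℕ∞) (Function.uncurry fun x y => 2 * edgeA f x y / edgeE f x y)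
      (edgeDomain f) :=
  contDiffOn_div_edgeE (g := fun x y => 2 * edgeA f x y) hf
    (contDiffOn_const.mul (contDiffOn_edgeA hf))

lemma contDiffOn_edgeMat {f : ℝ → ℝ → ℝ} (hf : ContDiff ℝ (⊤ : ℕ∞) (Function.uncurry f))
    (i j : Fin 2) : ContDiffOn ℝ (⊤ : ℕ∞) (Function.uncurry (edgeMat f i j)) (edgeDomain f) := by
  have h11 : ContDiffOn ℝ (⊤ : ℕ∞) (Function.uncurry (edgeMat f 0 0)) (edgeDomain f) :=
    contDiffOn_div_edgeE hf (contDiff_edgeN hf).contDiffOn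
  have h12 : ContDiffOn ℝ (⊤ : ℕ∞) (Function.uncurry (edgeMat f 0 1)) (edgeDomain f) :=
    contDiffOn_snd.mul (contDiffOn_div_edgeE (g := fun x y => -2 * pd1 (pd2 f) x y) hf
      (contDiff_const.mul (contDiff_pd (contDiff_pd hf).2).1).contDiffOn)
  have h22 : ContDiffOn ℝ (⊤ : ℕ∞) (Function.uncurry (edgeMat f 1 1)) (edgeDomain f) :=
    contDiffOn_snd.mul (contDiffOn_edgeA_div hf)
  fin_cases i <;> fin_cases j
  exacts [h11, h12, h12, h22]

lemma uCurv_eq {f : ℝ → ℝ → ℝ} (hf : ContDiff ℝ (⊤ : ℕ∞) (Function.uncurry f)) {x y : ℝ}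
    (hx : x ≠ 0) (hy : y ≠ 0) (i j k l : Fin 2) :
    uCurv f i j k l x y = pdI k (pdI l (edgeMat f i j)) x y := by
  have hV : IsOpen ({p : ℝ × ℝ | p.1 ≠ 0} ∩ {p | p.2 ≠ 0}) :=
    isOpen_ne_zero_fst.inter (isOpen_ne_fun continuous_snd continuous_const)
  have h : EqOn (Function.uncurry (uInvMat f i j)) (Function.uncurry (edgeMat f i j))
      ({p : ℝ × ℝ | p.1 ≠ 0} ∩ {p | p.2 ≠ 0}) := fun p hp => uInvMat_eq hf hp.1 hp.2 i j
  exact eqOn_pdI k hV (eqOn_pdI l hV h) (x := (x, y)) ⟨hx, hy⟩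

lemma edgeE_zero (f : ℝ → ℝ → ℝ) (x : ℝ) : edgeE f x 0 = edgeA f x 0 := by
  simp [edgeE, edgeN]

/-- Boundedness of `u¹¹₂₂` at the edge prevents the rescaled determinant from vanishing there. -/
lemma edgeE_ne_zero {f : ℝ → ℝ → ℝ} (hf : ContDiff ℝ (⊤ : ℕ∞) (Function.uncurry f)) {x : ℝ}
    (hx : x ≠ 0) (hD : ∀ᶠ y in 𝓝[>] (0 : ℝ), hessDet f x y ≠ 0) {c : ℝ}
    (hc : Tendsto (fun y => uCurv f 0 0 1 1 x y) (𝓝[>] 0) (𝓝 c)) : edgeE f x 0 ≠ 0 := by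
  have hE : ∀ᶠ y in 𝓝[>] (0 : ℝ), (x, y) ∈ edgeDomain f := by
    filter_upwards [hD, self_mem_nhdsWithin] with y hy hy0
    refine ⟨hx, fun h0 => hy ?_⟩
    have h0' : edgeE f x y = 0 := h0
    rw [hessDet_eq hf hx (ne_of_gt hy0), h0', zero_div]
  have hU := isOpen_edgeDomain hf
  have hslice : ∀ {g : ℝ → ℝ → ℝ},
      ContDiffOn ℝ (⊤ : ℕ∞) (Function.uncurry g) (edgeDomain f) →
      ∀ᶠ y in 𝓝[>] (0 : ℝ), DifferentiableAt ℝ (g x) y := fun {g} hg => by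
    filter_upwards [hE] with y hy
    have h := hg.differentiableAt_of_isOpen hU hy
    exact DifferentiableAt.comp (f := fun s : ℝ => (x, s)) y h (by fun_prop)
  have hF := contDiffOn_edgeMat hf 0 0
  have hb2 : deriv (pd2 (edgeMat f 0 0) x) =O[𝓝[>] (0 : ℝ)] (fun _ => (1 : ℝ)) := by
    refine (hc.congr' ?_).isBigO_one ℝ
    filter_upwards [self_mem_nhdsWithin] with y hy
    exact uCurv_eq hf hx (ne_of_gt hy) 0 0 1 1
  have hb1 : deriv (edgeMat f 0 0 x) =O[𝓝[>] (0 : ℝ)] (fun _ => (1 : ℝ)) :=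
    isBigO_one_of_deriv (hslice (contDiffOn_pd2 hU hF)) hb2
  have hb0 := isBigO_one_of_deriv (hslice hF) hb1
  have hline : Continuous fun y : ℝ => (x, y) := by fun_prop
  have hEt : Tendsto (fun y => edgeE f x y) (𝓝[>] 0) (𝓝 (edgeE f x 0)) := by
    have h : ContinuousAt (Function.uncurry (edgeE f)) (x, 0) :=
      (contDiffOn_edgeE hf).continuousOn.continuousAt (isOpen_ne_zero_fst.mem_nhds hx)
    exact (h.tendsto.comp (hline.tendsto 0)).mono_left nhdsWithin_le_nhds
  have hNt : Tendsto (fun y => edgeN f x y) (𝓝[>] 0) (𝓝 1) := by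
    have h : Tendsto (fun y => edgeN f x y) (𝓝 0) (𝓝 (edgeN f x 0)) :=
      ((contDiff_edgeN hf).continuous.comp hline).tendsto 0
    have h1 : edgeN f x 0 = 1 := by simp [edgeN]
    exact h1 ▸ h.mono_left nhdsWithin_le_nhds
  intro h0
  rw [h0] at hEt
  have hlim := (hb0.mul_isLittleO ((Asymptotics.isLittleO_one_iff ℝ).2 hEt))
  simp only [mul_one] at hlim
  have hz := (Asymptotics.isLittleO_one_iff ℝ).1 hlim
  refine one_ne_zero (tendsto_nhds_unique (hNt.congr' ?_) hz)
  filter_upwards [hE] with y hy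
  exact (div_mul_cancel₀ _ hy.2).symm

lemma pd2_snd_mul {g : ℝ → ℝ → ℝ} {x : ℝ}
    (hg : DifferentiableAt ℝ (Function.uncurry g) (x, 0)) :
    pd2 (fun x y => y * g x y) x 0 = g x 0 := by
  have h : DifferentiableAt ℝ (fun s => g x s) 0 :=
    DifferentiableAt.comp (f := fun s : ℝ => (x, s)) 0 hg (by fun_prop)
  exact ((hasDerivAt_id (0 : ℝ)).mul h.hasDerivAt).deriv.trans (by simp)

lemma pd1_pd1_snd_mul (g : ℝ → ℝ → ℝ) (x : ℝ) : pd1 (pd1 fun x y => y * g x y) x 0 = 0 := by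
  simp [pd1]

lemma pd1_pd2_edgeMat {f : ℝ → ℝ → ℝ} (hf : ContDiff ℝ (⊤ : ℕ∞) (Function.uncurry f)) {x : ℝ}
    (hx : (x, (0 : ℝ)) ∈ edgeDomain f) : pd1 (pd2 (edgeMat f 1 1)) x 0 = 0 := by
  have hU := isOpen_edgeDomain hf
  have ht : Tendsto (fun s : ℝ => (s, (0 : ℝ))) (𝓝 x) (𝓝 (x, 0)) :=
    Continuous.tendsto (by fun_prop) x
  have h : (fun s => pd2 (edgeMat f 1 1) s 0) =ᶠ[𝓝 x] fun _ => (2 : ℝ) := by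
    filter_upwards [ht.eventually (hU.mem_nhds hx)] with s hs
    have hE : edgeE f s 0 ≠ 0 := hs.2
    refine (pd2_snd_mul ((contDiffOn_edgeA_div hf).differentiableAt_of_isOpen hU hs)).trans ?_
    rw [← edgeE_zero, mul_div_cancel_right₀ _ hE]
  exact h.deriv_eq.trans (deriv_const x 2)

/-- Fix `x₁ ∈ (0,1)` and assume that all the limits
`L^{ij}_{kl} = lim_{x₂→0⁺} u^{ij}_{kl}(x₁,x₂)` exist.  Then
`lim_{x₂→0⁺} Σ_{ijkl} u^{ij}_{kl} u^{kl}_{ij} = (L¹¹₁₁)² + 4 (L¹²₁₂)² + (L²²₂₂)²`,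
i.e. the squared curvature norm `|Rm|²` on the edge `x₂ = 0`. -/
theorem stmt2 (f : ℝ → ℝ → ℝ) (hf : ContDiff ℝ (⊤ : ℕ∞) (Function.uncurry f))
    (hpos : ∀ x ∈ Ioo (0:ℝ) 1, ∀ y ∈ Ioo (0:ℝ) 1,
      0 < hessDet f x y ∧ 0 < pd1 (pd1 (upot f)) x y)
    (x₁ : ℝ) (hx₁ : x₁ ∈ Ioo (0:ℝ) 1)
    (L : Fin 2 → Fin 2 → Fin 2 → Fin 2 → ℝ)
    (hL : ∀ i j k l : Fin 2,
      Tendsto (fun x₂ => uCurv f i j k l x₁ x₂) (𝓝[>] 0) (𝓝 (L i j k l))) :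
    Tendsto
      (fun x₂ => ∑ i : Fin 2, ∑ j : Fin 2, ∑ k : Fin 2, ∑ l : Fin 2,
        uCurv f i j k l x₁ x₂ * uCurv f k l i j x₁ x₂)
      (𝓝[>] 0)
      (𝓝 ((L 0 0 0 0) ^ 2 + 4 * (L 0 1 0 1) ^ 2 + (L 1 1 1 1) ^ 2)) := by
  have hx0 : x₁ ≠ 0 := ne_of_gt hx₁.1
  have hD : ∀ᶠ y in 𝓝[>] (0 : ℝ), hessDet f x₁ y ≠ 0 := by
    filter_upwards [Ioo_mem_nhdsGT one_pos] with y hy using ne_of_gt (hpos x₁ hx₁ y hy).1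
  have hU := isOpen_edgeDomain hf
  have hmem : (x₁, (0 : ℝ)) ∈ edgeDomain f := ⟨hx0, edgeE_ne_zero hf hx0 hD (hL 0 0 1 1)⟩
  have hval : ∀ i j k l, L i j k l = pdI k (pdI l (edgeMat f i j)) x₁ 0 := fun i j k l => by
    have hc := (contDiffOn_pdI k hU (contDiffOn_pdI l hU
      (contDiffOn_edgeMat hf i j))).continuousOn.continuousAt (hU.mem_nhds hmem)
    have ht : Tendsto (fun y : ℝ => (x₁, y)) (𝓝[>] 0) (𝓝 (x₁, 0)) :=
      (Continuous.tendsto (by fun_prop) 0).mono_left nhdsWithin_le_nhds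
    refine tendsto_nhds_unique (hL i j k l) ((hc.tendsto.comp ht).congr' ?_)
    filter_upwards [self_mem_nhdsWithin] with y hy
    exact (uCurv_eq hf hx0 (ne_of_gt hy) i j k l).symm
  have hsymm : ∀ i j, L i j 0 1 = L i j 1 0 := fun i j => by
    rw [hval, hval]
    exact pd1_pd2_comm hU (contDiffOn_edgeMat hf i j) hmem
  have h1100 : L 1 1 0 0 = 0 := (hval 1 1 0 0).trans
    (pd1_pd1_snd_mul (fun x y => 2 * edgeA f x y / edgeE f x y) x₁)
  have h0100 : L 0 1 0 0 = 0 := (hval 0 1 0 0).trans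
    (pd1_pd1_snd_mul (fun x y => -2 * pd1 (pd2 f) x y / edgeE f x y) x₁)
  have h1101 : L 1 1 0 1 = 0 := (hval 1 1 0 1).trans (pd1_pd2_edgeMat hf hmem)
  have hswap : ∀ k l, L 1 0 k l = L 0 1 k l := fun k l => by
    rw [hval, hval]
    rfl
  have hsum := tendsto_finsetSum Finset.univ fun i _ => tendsto_finsetSum Finset.univ
    fun j _ => tendsto_finsetSum Finset.univ fun k _ => tendsto_finsetSum Finset.univ
    fun l _ => (hL i j k l).mul (hL k l i j)
  convert hsum using 2
  simp only [Fin.sum_univ_two, hswap, ← hsymm, h1100, h0100, h1101]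
  ring
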